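/- Let R : ℝ² → ℝ be a bounded, continuous, radially symmetric function such that R(r) > 0 and R is non-increasing for r < 1, and R(r) ≤ 0 for r ≥ 1. Let η ≥ 4 and let u be a solution of −Δu = R e^u on ℝ² satisfying u(x) = −η log|x| + O(1) as |x| → ∞. Then u(μx) > u(μx/|x|²) − η log|x| for every x ∈ B(0,1) \ {0} and every μ ∈ (0,1]. -/

import Mathlib

open MeasureTheory Real Topology Filter Metric

noncomputable section

/-- The Euclidean plane. -/
abbrev R2 : Type := EuclideanSpace ℝ (Fin 2)

/-- The Laplacian `Δu = Σᵢ ∂²u/∂xᵢ²` on `ℝ²`. -/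
def lapR2 (u : R2 → ℝ) (x : R2) : ℝ :=
  ∑ i : Fin 2,
    fderiv ℝ (fun y => fderiv ℝ u y (EuclideanSpace.single i 1)) x (EuclideanSpace.single i 1)

/-- `u` is a classical `C²` solution of `−Δu = R e^u` on `ℝ²`. -/
def IsSolution (R u : R2 → ℝ) : Prop :=
  ContDiff ℝ 2 u ∧ ∀ x, -lapR2 u x = R x * Real.exp (u x)

/-- The asymptotic behaviour `u(x) = −η log |x| + O(1)` as `|x| → ∞`. -/
def AsympLog (η : ℝ) (u : R2 → ℝ) : Prop :=
  ∃ C : ℝ, ∀ x : R2, 1 ≤ ‖x‖ → |u x + η * Real.log ‖x‖| ≤ C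

/-- `lim_{|x|→∞} R(x) |x|^{4−η}` exists and lies in `(0, +∞)`. -/
def LimInfty (R : R2 → ℝ) (η : ℝ) : Prop :=
  ∃ L : ℝ, 0 < L ∧
    Tendsto (fun x : R2 => R x * ‖x‖ ^ (4 - η)) (Bornology.cobounded R2) (𝓝 L)

/-- The positivity region `R⁺`. -/
def Rplus (R : R2 → ℝ) : Set R2 := {x | 0 < R x}

/-- The negativity region `R⁻`. -/
def Rminus (R : R2 → ℝ) : Set R2 := {x | R x < 0}

/-- The nodal set `R⁰`. -/
def Rzero (R : R2 → ℝ) : Set R2 := {x | R x = 0}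

/-- Regularity hypothesis (reg): `R ∈ C⁰(ℝ²) ∩ C^{2,a}(U)` and `∇R ≠ 0` on
`cl(R⁺) ∩ cl(R⁻)`, where `U` is a neighbourhood of `cl(R⁺) ∩ cl(R⁻)`. -/
def RegHyp (R : R2 → ℝ) (U : Set R2) (a : NNReal) : Prop :=
  Continuous R ∧ IsOpen U ∧ closure (Rplus R) ∩ closure (Rminus R) ⊆ U ∧
    ContDiffOn ℝ 2 R U ∧ (∃ C : NNReal, HolderOnWith C a (iteratedFDeriv ℝ 2 R) U) ∧
    ∀ x ∈ closure (Rplus R) ∩ closure (Rminus R), gradient R x ≠ 0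

/-- The decomposition `R⁰ = (cl R⁺ ∩ cl R⁻) ⊔ 𝒬⁺ ⊔ 𝒬⁻`, where `𝒬^±` are the (possibly
empty) parts of the nodal set surrounded by the positive/negative nodal regions of `R`. -/
def QSpec (R : R2 → ℝ) (Qp Qm : Set R2) : Prop :=
  Rzero R = (closure (Rplus R) ∩ closure (Rminus R)) ∪ Qp ∪ Qm ∧
    Disjoint Qp Qm ∧
    Disjoint (closure (Rplus R) ∩ closure (Rminus R)) Qp ∧
    Disjoint (closure (Rplus R) ∩ closure (Rminus R)) Qm ∧
    frontier Qp ⊆ closure (Rplus R) \ closure (Rminus R) ∧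
    frontier Qm ⊆ closure (Rminus R) \ closure (Rplus R)

/-- Distance between two subsets of the plane (valued in `[0, ∞]`). -/
def esetDist (A B : Set R2) : ENNReal := ⨅ x ∈ A, EMetric.infEdist x B

/-- `r = (1/3) min { dist(𝒬⁺, cl R⁻), dist(𝒬⁻, cl R⁺) } > 0`. -/
def rSpec (R : R2 → ℝ) (Qp Qm : Set R2) (r : ℝ) : Prop :=
  0 < r ∧ r = (1 / 3) *
    (min (esetDist Qp (closure (Rminus R))) (esetDist Qm (closure (Rplus R)))).toReal


/-- second derivative test -/
lemma second_test {h h' : ℝ → ℝ} {d t : ℝ} (h1 : ∀ s, HasDerivAt h (h' s) s)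
    (h2 : HasDerivAt h' d t) (hm : IsLocalMin h t) : 0 ≤ d := by
  by_contra hd
  push Not at hd
  have e1 : deriv h = h' := funext fun s => (h1 s).deriv
  have hmax : IsLocalMax h t := by
    apply isLocalMax_of_deriv_deriv_neg
    · rw [e1, h2.deriv]; exact hd
    · exact hm.deriv_eq_zero
    · exact (h1 t).continuousAt
  have hc : h =ᶠ[𝓝 t] fun _ => h t := by
    filter_upwards [hm, hmax] with s a b using le_antisymm b a
  have h3 : deriv h =ᶠ[𝓝 t] deriv (fun _ => h t) := hc.deriv
  have h4 : deriv (deriv h) t = 0 := by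
    rw [h3.deriv_eq]; simp
  rw [e1, h2.deriv] at h4
  linarith

/-- `F` is continuous, periodic in the second variable, with Laplacian `L`. -/
def HasLap (F L : ℝ → ℝ → ℝ) : Prop :=
  Continuous (fun q : ℝ × ℝ => F q.1 q.2) ∧ (∀ t, Function.Periodic (F t) (2 * π)) ∧
  ∃ Ft Ftt Fx Fxx : ℝ → ℝ → ℝ,
    (∀ t x, HasDerivAt (fun t => F t x) (Ft t x) t) ∧
    (∀ t x, HasDerivAt (fun t => Ft t x) (Ftt t x) t) ∧
    (∀ t x, HasDerivAt (fun x => F t x) (Fx t x) x) ∧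
    (∀ t x, HasDerivAt (fun x => Fx t x) (Fxx t x) x) ∧
    ∀ t x, L t x = Ftt t x + Fxx t x

lemma strip_max {F L : ℝ → ℝ → ℝ} (hF : HasLap F L) {α β ε : ℝ} (hαβ : α ≤ β) (hε : 0 ≤ ε)
    {g g' g'' : ℝ → ℝ} (hg1 : ∀ t, HasDerivAt g (g' t) t) (hg2 : ∀ t, HasDerivAt g' (g'' t) t)
    (hgpos : ∀ t, α ≤ t → t ≤ β → 0 < g t)
    (hα : ∀ x, -ε * g α ≤ F α x) (hβ : ∀ x, -ε * g β ≤ F β x)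
    (hL : ∀ t x, α < t → t < β → F t x < 0 → L t x * g t < F t x * g'' t) :
    ∀ t x, α ≤ t → t ≤ β → -ε * g t ≤ F t x := by
  obtain ⟨hc, hper, Ft, Ftt, Fx, Fxx, h1, h2, h3, h4, h5⟩ := hF
  have hgc : Continuous g := continuous_iff_continuousAt.2 fun t => (hg1 t).continuousAt
  have hK : IsCompact (Set.Icc α β ×ˢ Set.Icc (0:ℝ) (2 * π)) := isCompact_Icc.prod isCompact_Icc
  have hne : (Set.Icc α β ×ˢ Set.Icc (0:ℝ) (2 * π)).Nonempty :=
    ⟨(α, 0), ⟨le_rfl, hαβ⟩, ⟨le_rfl, by positivity⟩⟩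
  obtain ⟨⟨t0, x0⟩, ⟨(ht0 : t0 ∈ _), (hx0 : x0 ∈ _)⟩, hmin⟩ := hK.exists_isMinOn (f := fun q : ℝ × ℝ => F q.1 q.2 / g q.1)
    hne (by
      apply ContinuousOn.div hc.continuousOn (hgc.comp continuous_fst).continuousOn
      rintro ⟨t, x⟩ ⟨ht, -⟩
      exact (hgpos t ht.1 ht.2).ne')
  have hmin' : ∀ t x, α ≤ t → t ≤ β → F t0 x0 / g t0 ≤ F t x / g t := by
    intro t x ha hb
    obtain ⟨y, hy, hxy⟩ := (hper t).exists_mem_Ico₀ (by positivity) x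
    rw [hxy]
    exact hmin (show (t, y) ∈ _ from ⟨⟨ha, hb⟩, ⟨hy.1, hy.2.le⟩⟩)
  by_contra hcon
  push Not at hcon
  obtain ⟨t1, x1, ha1, hb1, hlt⟩ := hcon
  have hm1 : F t0 x0 / g t0 < -ε :=
    (hmin' t1 x1 ha1 hb1).trans_lt (by rw [div_lt_iff₀ (hgpos t1 ha1 hb1)]; exact hlt)
  have hg0 := hgpos t0 ht0.1 ht0.2
  set m := - (F t0 x0 / g t0) with hm
  have hF0 : F t0 x0 = -m * g t0 := by rw [hm]; field_simp
  have hmpos : 0 < m := by linarith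
  have hF0' : F t0 x0 < -ε * g t0 := by rw [hF0]; nlinarith
  have hat : α < t0 := by
    rcases eq_or_lt_of_le ht0.1 with h | h
    · have := hα x0; rw [h] at this; linarith
    · exact h
  have hbt : t0 < β := by
    rcases eq_or_lt_of_le ht0.2 with h | h
    · have := hβ x0; rw [← h] at this; linarith
    · exact h
  have hge : ∀ t x, α ≤ t → t ≤ β → 0 ≤ F t x + m * g t := by
    intro t x ha hb
    have := hmin' t x ha hb
    rw [le_div_iff₀ (hgpos t ha hb)] at this
    have h6 : F t0 x0 / g t0 = -m := by rw [hm]; ring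
    rw [h6] at this; linarith
  have A := second_test (h := fun t => F t x0 + m * g t) (h' := fun t => Ft t x0 + m * g' t)
    (t := t0) (fun s => (h1 s x0).add ((hg1 s).const_mul m)) ((h2 t0 x0).add ((hg2 t0).const_mul m))
    (by
      filter_upwards [Ioo_mem_nhds hat hbt] with t ht
      have := hge t x0 ht.1.le ht.2.le
      beta_reduce; linarith)
  have B := second_test (h := fun x => F t0 x) (h' := fun x => Fx t0 x)
    (t := x0) (fun s => h3 t0 s) (h4 t0 x0)
    (by
      filter_upwards with x
      have := hge t0 x ht0.1 ht0.2
      linarith)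
  have C := hL t0 x0 hat hbt (by nlinarith)
  rw [h5, hF0] at C
  nlinarith

lemma HasLap.refl {V L : ℝ → ℝ → ℝ} (hV : HasLap V L) (l : ℝ) :
    HasLap (fun t x => V (l - t) x - V (l + t) x) (fun t x => L (l - t) x - L (l + t) x) := by
  obtain ⟨hc, hper, Ft, Ftt, Fx, Fxx, h1, h2, h3, h4, h5⟩ := hV
  have dm : ∀ t : ℝ, HasDerivAt (fun t => l - t) (-1) t := fun t => by
    simpa using (hasDerivAt_id t).const_sub l
  have dp : ∀ t : ℝ, HasDerivAt (fun t => l + t) 1 t := fun t => by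
    simpa using (hasDerivAt_id t).const_add l
  refine ⟨?_, fun t x => by simp [hper (l - t) x, hper (l + t) x],
    fun t x => - Ft (l - t) x - Ft (l + t) x, fun t x => Ftt (l - t) x - Ftt (l + t) x,
    fun t x => Fx (l - t) x - Fx (l + t) x, fun t x => Fxx (l - t) x - Fxx (l + t) x,
    fun t x => ?_, fun t x => ?_, fun t x => ?_, fun t x => ?_, fun t x => ?_⟩
  · exact (hc.comp (f := fun q : ℝ × ℝ => (l - q.1, q.2)) (by fun_prop)).sub
      (hc.comp (f := fun q : ℝ × ℝ => (l + q.1, q.2)) (by fun_prop))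
  · have a := (h1 (l - t) x).comp t (dm t)
    have b := (h1 (l + t) x).comp t (dp t)
    convert a.sub b using 1 <;> first | rfl | ring
  · have a := ((h2 (l - t) x).comp t (dm t)).neg
    have b := (h2 (l + t) x).comp t (dp t)
    convert a.sub b using 1 <;> first | rfl | ring
  · exact (h3 _ x).sub (h3 _ x)
  · exact (h4 _ x).sub (h4 _ x)
  · simp only [h5]; ring

lemma HasLap.sub_lin {F L : ℝ → ℝ → ℝ} (hF : HasLap F L) (k : ℝ) :
    HasLap (fun t x => F t x - k * t) L := by
  obtain ⟨hc, hper, Ft, Ftt, Fx, Fxx, h1, h2, h3, h4, h5⟩ := hF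
  refine ⟨?_, fun t x => by simp [hper t x],
    fun t x => Ft t x - k, Ftt, Fx, Fxx,
    fun t x => ?_, fun t x => ?_, fun t x => ?_, h4, h5⟩
  · exact hc.sub (by fun_prop)
  · exact (h1 t x).sub (by simpa using (hasDerivAt_id t).const_mul k)
  · exact (h2 t x).sub_const k
  · exact (h3 t x).sub_const _

/-- hypotheses for the moving plane method on the cylinder -/
structure Cyl (V : ℝ → ℝ → ℝ) (K : ℝ → ℝ) (a C M : ℝ) : Prop where
  lap : HasLap V (fun s x => -(K s * exp (V s x)))
  pos : ∀ s < 0, 0 < K s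
  anti : ∀ s t, s ≤ t → t < 0 → K t ≤ K s
  neg : ∀ s, 0 ≤ s → K s ≤ 0
  ha : 2 ≤ a
  hM : 0 ≤ M
  bK : ∀ s ≤ 0, K s ≤ M * exp ((2 - a) * s)
  up : ∀ s x, V s x ≤ C - a * s
  lo : ∀ s x, s ≤ 0 → a * s - C ≤ V s x

namespace Cyl
variable {V : ℝ → ℝ → ℝ} {K : ℝ → ℝ} {a C M : ℝ}

lemma Kle (h : Cyl V K a C M) {l t : ℝ} (hl : l ≤ 0) (ht : 0 < t) : K (l + t) ≤ K (l - t) := by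
  rcases lt_or_ge (l + t) 0 with h1 | h1
  · exact h.anti _ _ (by linarith) h1
  · exact (h.neg _ h1).trans (h.pos _ (by linarith)).le

lemma lap_nonpos (h : Cyl V K a C M) {l t x : ℝ} (hl : l ≤ 0) (ht : 0 < t)
    (hp : 0 ≤ V (l - t) x - V (l + t) x) :
    -(K (l - t) * exp (V (l - t) x)) - -(K (l + t) * exp (V (l + t) x)) ≤ 0 := by
  have h1 := h.Kle hl ht
  have h2 := h.pos (l - t) (by linarith)
  have h3 : exp (V (l + t) x) ≤ exp (V (l - t) x) := exp_le_exp.2 (by linarith)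
  have h4 := exp_pos (V (l + t) x)
  nlinarith

lemma lap_neg (h : Cyl V K a C M) {l t x : ℝ} (hl : l ≤ 0) (ht : 0 < t) (hlt : 0 ≤ l + t) :
    -(K (l - t) * exp (V (l - t) x)) - -(K (l + t) * exp (V (l + t) x)) < 0 := by
  have h1 := h.neg _ hlt
  have h2 := h.pos (l - t) (by linarith)
  have h3 := exp_pos (V (l + t) x)
  have h4 := exp_pos (V (l - t) x)
  nlinarith [mul_pos h2 h4]

lemma lap_le (h : Cyl V K a C M) {l0 l t x : ℝ} (hl : l ≤ 0) (hl0 : l0 ≤ l) (ht : 0 < t)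
    (hp : V (l - t) x - V (l + t) x < 0) :
    -(K (l - t) * exp (V (l - t) x)) - -(K (l + t) * exp (V (l + t) x)) ≤
      (M * exp (C + (2 - 2 * a) * l0)) * exp (-2 * t) * -(V (l - t) x - V (l + t) x) := by
  have h1 := h.Kle hl ht
  have h2 := h.pos (l - t) (by linarith)
  have ha := h.ha
  have e1 : exp (V (l + t) x) * (V (l - t) x - V (l + t) x + 1) ≤ exp (V (l - t) x) := by
    have := add_one_le_exp (V (l - t) x - V (l + t) x)
    calc _ ≤ exp (V (l + t) x) * exp (V (l - t) x - V (l + t) x) := by gcongr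
      _ = _ := by rw [← exp_add]; congr 1; ring
  have e2 : K (l - t) * exp (V (l + t) x) ≤ (M * exp (C + (2 - 2 * a) * l0)) * exp (-2 * t) := by
    have hM := h.hM
    calc K (l - t) * exp (V (l + t) x)
        ≤ (M * exp ((2 - a) * (l - t))) * exp (C - a * (l + t)) := by
          gcongr
          · exact h.bK _ (by linarith)
          · exact h.up _ _
      _ = M * exp (C + (2 - 2 * a) * l - 2 * t) := by
          rw [mul_assoc, ← exp_add]; congr 2; ring
      _ ≤ M * exp (C + (2 - 2 * a) * l0 - 2 * t) := by
          apply mul_le_mul_of_nonneg_left _ hM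
          apply exp_le_exp.2
          nlinarith
      _ = _ := by rw [mul_assoc, ← exp_add]; congr 2; ring
  have e3 := exp_pos (V (l + t) x)
  have e4 : K (l - t) * (exp (V (l + t) x) * (V (l - t) x - V (l + t) x + 1)) ≤
    K (l - t) * exp (V (l - t) x) := by gcongr
  have e5 : K (l + t) * exp (V (l + t) x) ≤ K (l - t) * exp (V (l + t) x) := by gcongr
  nlinarith [mul_le_mul_of_nonneg_right e2 (neg_nonneg.2 hp.le)]

lemma psi_lo (h : Cyl V K a C M) {l t x : ℝ} (hl : l ≤ 0) (ht : 0 ≤ t) :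
    2 * a * l - 2 * C ≤ V (l - t) x - V (l + t) x := by
  linarith [h.up (l + t) x, h.lo (l - t) x (by linarith)]

/-- strong maximum principle -/
lemma strong (h : Cyl V K a C M) {l : ℝ} (hl : l ≤ 0)
    (hn : ∀ t x, 0 ≤ t → 0 ≤ V (l - t) x - V (l + t) x) :
    ∀ t x, 0 < t → 0 < V (l - t) x - V (l + t) x := by
  have hF := h.lap.refl l
  have big : ∀ t x, 0 < t → 0 ≤ l + t → 0 < V (l - t) x - V (l + t) x := by
    intro t x ht hlt
    by_contra hcon
    have h0 : V (l - t) x - V (l + t) x = 0 := le_antisymm (not_lt.1 hcon) (hn t x ht.le)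
    obtain ⟨hc, hper, Ft, Ftt, Fx, Fxx, h1, h2, h3, h4, h5⟩ := hF
    have A := second_test (h1 · x) (h2 t x) (by
      filter_upwards [Ioi_mem_nhds ht] with s hs
      rw [h0]; exact hn s x (le_of_lt hs))
    have B := second_test (h3 t) (h4 t x) (by
      filter_upwards with y
      rw [h0]; exact hn t y ht.le)
    have C := h.lap_neg (x := x) hl ht hlt
    have D := h5 t x
    beta_reduce at D
    linarith
  intro t x ht
  rcases le_or_gt 0 (l + t) with hlt | hlt
  · exact big t x ht hlt
  have hlneg : 0 < -l := by linarith
  have hcont := hF.1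
  have hper := hF.2.1
  -- minimum on the circle t = -l
  obtain ⟨y, hy, hmin⟩ := (isCompact_Icc (a := (0:ℝ)) (b := 2 * π)).exists_isMinOn
    (f := fun y => V (l - -l) y - V (l + -l) y) ⟨0, le_rfl, by positivity⟩
    (hcont.comp (f := fun y : ℝ => (-l, y)) (by fun_prop)).continuousOn
  have hmpos := big (-l) y hlneg (by linarith)
  set m := V (l - -l) y - V (l + -l) y with hm
  have hmin' : ∀ z, m ≤ V (l - -l) z - V (l + -l) z := by
    intro z
    obtain ⟨z', hz', e⟩ := (hper (-l)).exists_mem_Ico₀ (by positivity) z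
    have := hmin (show z' ∈ Set.Icc 0 (2 * π) from ⟨hz'.1, hz'.2.le⟩)
    rw [show V (l - -l) z - V (l + -l) z = V (l - -l) z' - V (l + -l) z' from e]; exact this
  have key := strip_max (hF.sub_lin (m / -l)) (α := 0) (β := -l) (ε := 0) hlneg.le le_rfl
    (g := fun t => 1 + l ^ 2 - t ^ 2) (g' := fun t => -(2 * t)) (g'' := fun _ => -2)
    (fun t => by simpa using (hasDerivAt_pow 2 t).const_sub (1 + l ^ 2))
    (fun t => HasDerivAt.congr_deriv (f' := -(2 * 1)) ((hasDerivAt_id t).const_mul 2).neg (by norm_num))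
    (fun t h1 h2 => by nlinarith)
    (fun z => by simp)
    (fun z => by
      have e : m / -l * -l = m := div_mul_cancel₀ _ hlneg.ne'
      have := hmin' z
      simp only [e]; linarith)
    (fun s z h1 h2 h3 => by
      have := h.lap_nonpos (x := z) hl h1 (hn s z h1.le)
      beta_reduce at this h3 ⊢
      nlinarith [mul_nonneg (neg_nonneg.2 this) (show 0 ≤ 1 + l ^ 2 - s ^ 2 by nlinarith)])
    t x ht.le (by linarith)
  have : 0 < m / -l * t := by positivity
  beta_reduce at key
  linarith

lemma at_zero (h : Cyl V K a C M) : ∀ t x, 0 ≤ t → 0 ≤ V (0 - t) x - V (0 + t) x := by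
  intro t x ht
  apply le_of_forall_pos_lt_add
  intro δ hδ
  set ε := δ / (2 * (1 + t)) with hε
  have hεp : 0 < ε := by positivity
  set T := max t (2 * C / ε) with hT
  have hTt : t ≤ T := le_max_left _ _
  have hTC : 2 * C ≤ ε * T := by
    have := le_max_right t (2 * C / ε)
    rw [div_le_iff₀ hεp] at this
    linarith
  have := strip_max (h.lap.refl 0) (α := 0) (β := T) (ε := ε) (ht.trans hTt) hεp.le
    (g := fun t => 1 + t) (g' := fun _ => 1) (g'' := fun _ => 0)
    (fun t => by simpa using (hasDerivAt_id t).const_add 1)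
    (fun t => hasDerivAt_const _ _)
    (fun t h1 h2 => by linarith)
    (fun z => by simp [hεp.le])
    (fun z => by
      have := h.psi_lo (x := z) le_rfl (ht.trans hTt)
      beta_reduce; nlinarith)
    (fun s z h1 h2 h3 => by
      have := h.lap_neg (x := z) le_rfl h1 (by linarith)
      beta_reduce at this h3 ⊢
      nlinarith)
    t x ht hTt
  have e : ε * (1 + t) = δ / 2 := by rw [hε]; field_simp
  beta_reduce at this
  linarith

/-- one step to the left -/
lemma step (h : Cyl V K a C M) {l0 : ℝ} (hl0 : l0 ≤ 0)
    (hn : ∀ t x, 0 ≤ t → 0 ≤ V (l0 - t) x - V (l0 + t) x) :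
    ∃ e > 0, ∀ l, l0 - e < l → l ≤ l0 → ∀ t x, 0 ≤ t → 0 ≤ V (l - t) x - V (l + t) x := by
  have hst := h.strong hl0 hn
  set B := M * exp (C + (2 - 2 * a) * (l0 - 1)) + 1 with hB
  have hM := h.hM
  have hB1 : 1 ≤ B := by rw [hB]; linarith [show 0 ≤ M * exp (C + (2 - 2 * a) * (l0 - 1)) by positivity]
  have lapB : ∀ l t x, l0 - 1 ≤ l → l ≤ l0 → 0 < t → V (l - t) x - V (l + t) x < 0 →
      -(K (l - t) * exp (V (l - t) x)) - -(K (l + t) * exp (V (l + t) x)) ≤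
      B * exp (-2 * t) * -(V (l - t) x - V (l + t) x) := by
    intro l t x h1 h2 h3 h4
    refine (h.lap_le (h2.trans hl0) h1 h3 h4).trans ?_
    have : 0 ≤ -(V (l - t) x - V (l + t) x) := by linarith
    gcongr
    rw [hB]; linarith
  -- choose δ and T
  set δ := 1 / (2 * B) with hδ
  have hδp : 0 < δ := by positivity
  have hδB : B * δ = 1 / 2 := by rw [hδ]; field_simp
  have hδ1 : δ ≤ 1 / 2 := by nlinarith
  have hgB : ∀ t, 0 ≤ t → t ≤ δ → 0 < 1 - B * t ^ 2 := fun t h1 h2 => by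
    have : B * t ^ 2 ≤ B * δ ^ 2 := by gcongr
    nlinarith
  obtain ⟨T, hTδ, hT⟩ : ∃ T, δ ≤ T ∧ ∀ t, T ≤ t → B * (1 + t) < exp t := by
    have h1 : Tendsto (fun t : ℝ => exp t / t ^ 1) atTop atTop := tendsto_exp_div_pow_atTop 1
    have h2 := (h1.eventually_gt_atTop (2 * B)).and (eventually_ge_atTop 1)
    obtain ⟨T, hT⟩ := eventually_atTop.1 h2
    refine ⟨max T δ, le_max_right _ _, fun t ht => ?_⟩
    obtain ⟨h3, h4⟩ := hT t ((le_max_left _ _).trans ht)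
    rw [pow_one, lt_div_iff₀ (by linarith)] at h3
    nlinarith
  -- compactness
  have hV := h.lap.1
  have hper := h.lap.2.1
  have hev : ∀ᶠ l in 𝓝 l0, ∀ q ∈ Set.Icc δ T ×ˢ Set.Icc (0:ℝ) (2 * π),
      0 < V (l - q.1) q.2 - V (l + q.1) q.2 := by
    apply IsCompact.eventually_forall_of_forall_eventually (isCompact_Icc.prod isCompact_Icc)
    rintro ⟨t, x⟩ ⟨ht, hx⟩
    have hc : Continuous (fun z : ℝ × (ℝ × ℝ) => V (z.1 - z.2.1) z.2.2 - V (z.1 + z.2.1) z.2.2) :=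
      (hV.comp (f := fun z : ℝ × (ℝ × ℝ) => (z.1 - z.2.1, z.2.2)) (by fun_prop)).sub
      (hV.comp (f := fun z : ℝ × (ℝ × ℝ) => (z.1 + z.2.1, z.2.2)) (by fun_prop))
    exact hc.continuousAt.eventually (Ioi_mem_nhds (hst t x (hδp.trans_le ht.1)))
  obtain ⟨e, he, hball⟩ := Metric.eventually_nhds_iff.1 hev
  refine ⟨min e 1, by positivity, fun l hl1 hl2 => ?_⟩
  have hle : l0 - e < l := by linarith [min_le_left e 1]
  have hl1' : l0 - 1 ≤ l := by linarith [min_le_right e 1]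
  have hln : l ≤ 0 := hl2.trans hl0
  have mid : ∀ t x, δ ≤ t → t ≤ T → 0 < V (l - t) x - V (l + t) x := by
    intro t x h1 h2
    obtain ⟨y, hy, hxy⟩ := ((h.lap.refl l).2.1 t).exists_mem_Ico₀ (by positivity) x
    beta_reduce at hxy
    rw [hxy]
    exact hball (y := l) (by rw [Real.dist_eq, abs_lt]; constructor <;> linarith) (t, y)
      ⟨⟨h1, h2⟩, ⟨hy.1, hy.2.le⟩⟩
  intro t x ht
  rcases le_or_gt t δ with htδ | htδ
  · have := strip_max (h.lap.refl l) (α := 0) (β := δ) (ε := 0) hδp.le le_rfl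
      (g := fun t => 1 - B * t ^ 2) (g' := fun t => -(B * (2 * t))) (g'' := fun _ => -(B * 2))
      (fun t => by simpa using ((hasDerivAt_pow 2 t).const_mul B).const_sub 1)
      (fun t => HasDerivAt.congr_deriv (f' := -(B * (2 * 1)))
        (((hasDerivAt_id t).const_mul 2).const_mul B).neg (by norm_num))
      (fun t h1 h2 => hgB t h1 h2)
      (fun z => by simp)
      (fun z => by
        have := mid δ z le_rfl hTδ
        beta_reduce; linarith)
      (fun s z h1 h2 h3 => by
        have h4 := lapB l s z hl1' hl2 h1 h3
        beta_reduce at h3 h4 ⊢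
        set Y := -(V (l - s) z - V (l + s) z) with hY
        have hYp : 0 < Y := by rw [hY]; linarith
        have h5 : exp (-2 * s) ≤ 1 := exp_le_one_iff.2 (by linarith)
        have h6 : B * exp (-2 * s) * Y ≤ B * Y := by
          have : B * exp (-2 * s) ≤ B := by nlinarith
          nlinarith
        have h7 : 0 < 1 - B * s ^ 2 := hgB s h1.le h2.le
        have h8 : 1 - B * s ^ 2 ≤ 1 := by nlinarith [sq_nonneg s]
        have h9 : V (l - s) z - V (l + s) z = -Y := by rw [hY]; ring
        rw [h9]
        have h10 : 0 < B * Y := by positivity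
        have h11 := mul_le_mul_of_nonneg_right (h4.trans h6) h7.le
        nlinarith)
      t x ht htδ
    simpa using this
  rcases le_or_gt t T with htT | htT
  · exact (mid t x htδ.le htT).le
  have hTp : 0 < T := hδp.trans_le hTδ
  apply le_of_forall_pos_lt_add
  intro d hd
  set ε := d / (2 * (1 + t)) with hε
  have hεp : 0 < ε := by positivity
  set D := -(2 * a * l - 2 * C) with hD
  set T' := max t (D / ε) with hT'
  have hTt : t ≤ T' := le_max_left _ _
  have hTC : D ≤ ε * T' := by
    have := le_max_right t (D / ε)
    rw [div_le_iff₀ hεp] at this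
    linarith
  have gpos : ∀ s : ℝ, 0 ≤ s → s ≤ 1 + s - exp (-s) := fun s hs => by
    have : exp (-s) ≤ 1 := exp_le_one_iff.2 (by linarith)
    linarith
  have dexp : ∀ s : ℝ, HasDerivAt (fun s : ℝ => exp (-s)) (-exp (-s)) s := fun s => by
    simpa using (hasDerivAt_neg s).exp
  have := strip_max (h.lap.refl l) (α := T) (β := T') (ε := ε) (htT.le.trans hTt) hεp.le
    (g := fun t => 1 + t - exp (-t)) (g' := fun t => 1 + exp (-t)) (g'' := fun t => -exp (-t))
    (fun t => HasDerivAt.congr_deriv (f' := 1 - -exp (-t))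
      (((hasDerivAt_id t).const_add 1).sub (dexp t)) (by ring))
    (fun t => by simpa using (dexp t).const_add 1)
    (fun t h1 h2 => by linarith [gpos t (by linarith)])
    (fun z => by
      have h1 := mid T z hTδ le_rfl
      have h2 := gpos T hTp.le
      beta_reduce; nlinarith)
    (fun z => by
      have h1 := h.psi_lo (x := z) hln (ht.trans hTt)
      have h2 := gpos T' (ht.trans hTt)
      beta_reduce; nlinarith)
    (fun s z h1 h2 h3 => by
      have hs : 0 < s := by linarith
      have h4 := lapB l s z hl1' hl2 hs h3
      beta_reduce at h3 h4 ⊢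
      set Y := -(V (l - s) z - V (l + s) z) with hY
      have hYp : 0 < Y := by rw [hY]; linarith
      have h9 : V (l - s) z - V (l + s) z = -Y := by rw [hY]; ring
      rw [h9]
      have hg := gpos s hs.le
      have hg2 : 1 + s - exp (-s) ≤ 1 + s := by linarith [exp_pos (-s)]
      have h5 := hT s h1.le
      have h6 : B * exp (-2 * s) * (1 + s) < exp (-s) := by
        calc B * exp (-2 * s) * (1 + s) = exp (-2 * s) * (B * (1 + s)) := by ring
          _ < exp (-2 * s) * exp s := by gcongr
          _ = exp (-s) := by rw [← exp_add]; congr 1; ring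
      calc _ ≤ B * exp (-2 * s) * Y * (1 + s - exp (-s)) := by
              apply mul_le_mul_of_nonneg_right h4; linarith
        _ ≤ B * exp (-2 * s) * Y * (1 + s) := by gcongr
        _ = B * exp (-2 * s) * (1 + s) * Y := by ring
        _ < exp (-s) * Y := by gcongr
        _ = _ := by ring)
    t x htT.le hTt
  have e : ε * (1 + t) = d / 2 := by rw [hε]; field_simp
  have := exp_pos (-t)
  beta_reduce at *
  nlinarith

lemma main_nonneg (h : Cyl V K a C M) : ∀ l ≤ 0, ∀ t x, 0 ≤ t → 0 ≤ V (l - t) x - V (l + t) x := by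
  by_contra hcon
  push Not at hcon
  set S : Set ℝ := {l | l ≤ 0 ∧ ∃ t x, 0 ≤ t ∧ V (l - t) x - V (l + t) x < 0} with hS
  have hne : S.Nonempty := by
    obtain ⟨l, h1, h2⟩ := hcon
    exact ⟨l, h1, h2⟩
  have hbd : BddAbove S := ⟨0, fun l hl => hl.1⟩
  set l0 := sSup S with hl0
  have hl0n : l0 ≤ 0 := csSup_le hne fun l hl => hl.1
  have hgt : ∀ l, l0 < l → l ≤ 0 → ∀ t x, 0 ≤ t → 0 ≤ V (l - t) x - V (l + t) x := by
    intro l h1 h2 t x ht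
    by_contra hc
    exact absurd (le_csSup hbd (show l ∈ S from ⟨h2, t, x, ht, not_le.1 hc⟩)) (not_le.2 h1)
  have hn : ∀ t x, 0 ≤ t → 0 ≤ V (l0 - t) x - V (l0 + t) x := by
    rcases eq_or_lt_of_le hl0n with h0 | h0
    · rw [h0]; exact h.at_zero
    intro t x ht
    have hV := h.lap.1
    have hc : Continuous (fun l => V (l - t) x - V (l + t) x) :=
      (hV.comp (f := fun l : ℝ => (l - t, x)) (by fun_prop)).sub
      (hV.comp (f := fun l : ℝ => (l + t, x)) (by fun_prop))
    refine ge_of_tendsto (x := 𝓝[>] l0) (hc.continuousAt.tendsto.mono_left nhdsWithin_le_nhds) ?_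
    filter_upwards [Ioo_mem_nhdsGT h0] with l hl
    exact hgt l hl.1 hl.2.le t x ht
  obtain ⟨e, he, hstep⟩ := h.step hl0n hn
  obtain ⟨l, hlS, hl⟩ := exists_lt_of_lt_csSup hne (show l0 - e < sSup S by linarith)
  obtain ⟨hl00, t, x, ht, hlt⟩ := hlS
  exact absurd (hstep l hl (le_csSup hbd ⟨hl00, t, x, ht, hlt⟩) t x ht) (not_le.2 hlt)

lemma main_pos (h : Cyl V K a C M) {l t : ℝ} (x : ℝ) (hl : l ≤ 0) (ht : 0 < t) :
    0 < V (l - t) x - V (l + t) x :=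
  h.strong hl (h.main_nonneg l hl) t x ht

end Cyl

lemma curve1 {u : R2 → ℝ} (hu : ContDiff ℝ 2 u) {γ : ℝ → R2} {v : R2} {t : ℝ}
    (h1 : HasDerivAt γ v t) :
    HasDerivAt (fun t => u (γ t)) (fderiv ℝ u (γ t) v) t :=
  (((hu.differentiable (by norm_num)) (γ t)).hasFDerivAt).comp_hasDerivAt t h1

lemma curve2 {u : R2 → ℝ} (hu : ContDiff ℝ 2 u) {γ γ' : ℝ → R2} {w : R2} {t : ℝ}
    (h1 : HasDerivAt γ (γ' t) t) (h2 : HasDerivAt γ' w t) :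
    HasDerivAt (fun t => fderiv ℝ u (γ t) (γ' t))
      (fderiv ℝ (fderiv ℝ u) (γ t) (γ' t) (γ' t) + fderiv ℝ u (γ t) w) t := by
  have hd : Differentiable ℝ (fderiv ℝ u) :=
    (hu.fderiv_right (m := 1) (by norm_num)).differentiable (by norm_num)
  have := ((hd (γ t)).hasFDerivAt).comp_hasDerivAt t h1
  exact this.clm_apply h2

/-- unit coordinate vectors -/
def E0 : R2 := EuclideanSpace.single 0 1
def E1 : R2 := EuclideanSpace.single 1 1

/-- log-polar coordinates -/
def pol (s θ : ℝ) : R2 := exp s • (cos θ • E0 + sin θ • E1)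
def polJ (s θ : ℝ) : R2 := exp s • (-sin θ • E0 + cos θ • E1)

lemma lap_eq {u : R2 → ℝ} (hu : ContDiff ℝ 2 u) (x : R2) :
    lapR2 u x = fderiv ℝ (fderiv ℝ u) x E0 E0 + fderiv ℝ (fderiv ℝ u) x E1 E1 := by
  have hd : Differentiable ℝ (fderiv ℝ u) :=
    (hu.fderiv_right (m := 1) (by norm_num)).differentiable (by norm_num)
  have key : ∀ v : R2, fderiv ℝ (fun y => fderiv ℝ u y v) x v = fderiv ℝ (fderiv ℝ u) x v v := by
    intro v
    have := ((hd x).hasFDerivAt).clm_apply (hasFDerivAt_const v x)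
    rw [this.fderiv]; simp
  simp only [lapR2, Fin.sum_univ_two, key]; rfl

lemma pol_s (s θ : ℝ) : HasDerivAt (fun s => pol s θ) (pol s θ) s :=
  (hasDerivAt_exp s).smul_const _

lemma pol_dir (θ : ℝ) : HasDerivAt (fun θ => cos θ • E0 + sin θ • E1)
    (-sin θ • E0 + cos θ • E1) θ :=
  ((hasDerivAt_cos θ).smul_const _).add ((hasDerivAt_sin θ).smul_const _)

lemma pol_t (s θ : ℝ) : HasDerivAt (fun θ => pol s θ) (polJ s θ) θ :=
  (pol_dir θ).const_smul (exp s)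

lemma polJ_t (s θ : ℝ) : HasDerivAt (fun θ => polJ s θ) (-pol s θ) θ := by
  have : HasDerivAt (fun θ => -sin θ • E0 + cos θ • E1) (-cos θ • E0 + -sin θ • E1) θ :=
    ((hasDerivAt_sin θ).neg.smul_const _).add ((hasDerivAt_cos θ).smul_const _)
  have h2 : exp s • (-cos θ • E0 + -sin θ • E1) = -pol s θ := by
    rw [pol]; module
  rw [← h2]
  exact this.const_smul (exp s)

lemma norm_pol (s θ : ℝ) : ‖pol s θ‖ = exp s := by
  rw [pol, norm_smul]
  have : ‖cos θ • E0 + sin θ • E1‖ = 1 := by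
    rw [EuclideanSpace.norm_eq]
    simp [E0, E1, Fin.sum_univ_two]
  rw [this]; simp

lemma pol_cont : Continuous (fun q : ℝ × ℝ => pol q.1 q.2) := by
  unfold pol; fun_prop

lemma exists_pol (x : R2) (hx : x ≠ 0) : ∃ θ, x = pol (Real.log ‖x‖) θ := by
  have hn : 0 < ‖x‖ := norm_pos_iff.2 hx
  set z : ℂ := ⟨x 0, x 1⟩ with hz
  have hnz : ‖z‖ = ‖x‖ := by
    rw [EuclideanSpace.norm_eq, Complex.norm_def, Complex.normSq_apply]
    simp [Fin.sum_univ_two, hz, sq]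
  refine ⟨z.arg, ?_⟩
  have h1 := Complex.norm_mul_cos_arg z
  have h2 := Complex.norm_mul_sin_arg z
  rw [hnz] at h1 h2
  have hre : z.re = x 0 := rfl
  have him : z.im = x 1 := rfl
  clear_value z
  ext i
  rw [pol, exp_log hn]
  fin_cases i
  · simp [E0, E1, h1, hre]
  · simp [E0, E1, h2, him]

lemma pol_smul (s θ c : ℝ) : exp c • pol s θ = pol (c + s) θ := by
  rw [pol, pol, smul_smul, exp_add]

lemma hasLap_pol {R u : R2 → ℝ} (hu : IsSolution R u) (a : ℝ) :
    HasLap (fun s θ => u (pol s θ) + a * s)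
      (fun s θ => -(exp (2 * s) * (R (pol s θ) * exp (u (pol s θ))))) := by
  obtain ⟨hC, heq⟩ := hu
  refine ⟨?_, fun s θ => by simp [pol], fun s θ => fderiv ℝ u (pol s θ) (pol s θ) + a,
    fun s θ => fderiv ℝ (fderiv ℝ u) (pol s θ) (pol s θ) (pol s θ) + fderiv ℝ u (pol s θ) (pol s θ),
    fun s θ => fderiv ℝ u (pol s θ) (polJ s θ),
    fun s θ => fderiv ℝ (fderiv ℝ u) (pol s θ) (polJ s θ) (polJ s θ)
      + fderiv ℝ u (pol s θ) (-pol s θ),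
    fun s θ => ?_, fun s θ => ?_, fun s θ => ?_, fun s θ => ?_, fun s θ => ?_⟩
  · exact (hC.continuous.comp pol_cont).add (by fun_prop)
  · exact (curve1 hC (pol_s s θ)).add (by simpa using (hasDerivAt_id s).const_mul a)
  · exact (curve2 hC (γ := fun s => pol s θ) (γ' := fun s => pol s θ) (pol_s s θ) (pol_s s θ)).add_const a
  · exact (curve1 hC (pol_t s θ)).add_const _
  · exact curve2 hC (pol_t s θ) (polJ_t s θ)
  · beta_reduce
    rw [← heq, lap_eq hC]
    set H := fderiv ℝ (fderiv ℝ u) (pol s θ)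
    set G := fderiv ℝ u (pol s θ)
    have e : H (pol s θ) (pol s θ) + H (polJ s θ) (polJ s θ) =
        exp s ^ 2 * (cos θ ^ 2 + sin θ ^ 2) * (H E0 E0 + H E1 E1) := by
      simp only [pol, polJ, map_smul, map_add, smul_eq_mul, ContinuousLinearMap.smul_apply,
        ContinuousLinearMap.add_apply]
      ring
    rw [cos_sq_add_sin_sq, mul_one] at e
    have e2 : exp (2 * s) = exp s ^ 2 := by rw [← exp_nat_mul]; norm_num
    rw [e2, map_neg]
    linarith

/-- **Lemma 2.14.**  Let `R` be bounded, continuous and radially symmetric, with `R(r) > 0`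
and non-increasing for `r < 1`, and `R(r) ≤ 0` for `r ≥ 1`.  Let `η ≥ 4` and let `u` solve
`−Δu = R e^u` on `ℝ²` with `u = −η log|x| + O(1)`.  Then
`u(μx) > u(μx/|x|²) − η log|x|` for every `x ∈ B(0,1) \ {0}` and every `μ ∈ (0,1]`. -/
theorem statement11 (R : R2 → ℝ) (hc : Continuous R) (hbdd : ∃ M : ℝ, ∀ x, |R x| ≤ M)
    (f : ℝ → ℝ) (hrad : ∀ x : R2, R x = f ‖x‖)
    (hpos : ∀ s : ℝ, 0 ≤ s → s < 1 → 0 < f s)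
    (hmono : AntitoneOn f (Set.Ico (0 : ℝ) 1))
    (hneg : ∀ s : ℝ, 1 ≤ s → f s ≤ 0)
    (η : ℝ) (hη : 4 ≤ η)
    (u : R2 → ℝ) (hu : IsSolution R u) (hasymp : AsympLog η u) :
    ∀ x : R2, x ≠ 0 → ‖x‖ < 1 → ∀ μ : ℝ, 0 < μ → μ ≤ 1 →
      u ((μ / ‖x‖ ^ 2) • x) - η * Real.log ‖x‖ < u (μ • x) := by
  have hMain : ∃ C M, Cyl (fun s θ => u (pol s θ) + η / 2 * s)
      (fun s => exp ((2 - η / 2) * s) * f (exp s)) (η / 2) C M := by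
    obtain ⟨M, hM⟩ := hbdd
    obtain ⟨C2, hC2⟩ := hasymp
    obtain ⟨C1, hC1⟩ := (isCompact_closedBall (0 : R2) 1).exists_bound_of_continuousOn
      hu.1.continuous.continuousOn
    have hb1 : ∀ s θ, s ≤ 0 → |u (pol s θ)| ≤ C1 := fun s θ hs => by
      have := hC1 (pol s θ) (by simpa [norm_pol] using hs)
      simpa using this
    have hb2 : ∀ s θ, 0 ≤ s → |u (pol s θ) + η * s| ≤ C2 := fun s θ hs => by
      have := hC2 (pol s θ) (by simpa [norm_pol] using hs)
      simpa [norm_pol] using this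
    refine ⟨max C1 C2, M, ?_, ?_, ?_, ?_, by linarith, (abs_nonneg _).trans (hM 0), ?_, ?_, ?_⟩
    · convert hasLap_pol hu (η / 2) using 4 with s θ
      rw [hrad, norm_pol]
      have : exp ((2 - η / 2) * s) * exp (u (pol s θ) + η / 2 * s) =
          exp (2 * s) * exp (u (pol s θ)) := by
        rw [← exp_add, ← exp_add]; congr 1; ring
      linear_combination (f (exp s)) * this
    · intro s hs
      exact mul_pos (exp_pos _) (hpos _ (exp_pos s).le (exp_lt_one_iff.2 hs))
    · intro s t hst ht
      have h1 : f (exp t) ≤ f (exp s) :=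
        hmono ⟨(exp_pos s).le, exp_lt_one_iff.2 (by linarith)⟩ ⟨(exp_pos t).le, exp_lt_one_iff.2 ht⟩
          (exp_le_exp.2 hst)
      have h2 : exp ((2 - η / 2) * t) ≤ exp ((2 - η / 2) * s) := exp_le_exp.2 (by nlinarith)
      have h3 := (hpos _ (exp_pos t).le (exp_lt_one_iff.2 ht)).le
      exact mul_le_mul h2 h1 h3 (exp_pos _).le
    · intro s hs
      exact mul_nonpos_of_nonneg_of_nonpos (exp_pos _).le (hneg _ (one_le_exp hs))
    · intro s hs
      have h1 := (le_abs_self _).trans (hM (pol s 0))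
      rw [hrad, norm_pol] at h1
      beta_reduce
      rw [mul_comm]
      gcongr
    · intro s θ
      rcases le_total s 0 with hs | hs
      · have := (abs_le.1 (hb1 s θ hs)).2
        have := le_max_left C1 C2
        beta_reduce; nlinarith
      · have := (abs_le.1 (hb2 s θ hs)).2
        have := le_max_right C1 C2
        beta_reduce; linarith
    · intro s θ hs
      have := (abs_le.1 (hb1 s θ hs)).1
      have := le_max_left C1 C2
      beta_reduce; linarith
  obtain ⟨C, M, hcyl⟩ := hMain
  intro x hx hx1 μ hμ hμ1
  have hn : 0 < ‖x‖ := norm_pos_iff.2 hx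
  obtain ⟨θ, hθ⟩ := exists_pol x hx
  have hlog : Real.log ‖x‖ < 0 := Real.log_neg hn hx1
  have := hcyl.main_pos (l := Real.log μ) (t := -Real.log ‖x‖) θ
    (Real.log_nonpos hμ.le hμ1) (by linarith)
  have e1 : μ • x = pol (Real.log μ - -Real.log ‖x‖) θ := by
    conv_lhs => rw [hθ, ← exp_log hμ, pol_smul]
    congr 1; ring
  have e2 : (μ / ‖x‖ ^ 2) • x = pol (Real.log μ + -Real.log ‖x‖) θ := by
    have e3 : μ / ‖x‖ ^ 2 = exp (Real.log μ - 2 * Real.log ‖x‖) := by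
      rw [exp_sub, exp_log hμ, show 2 * Real.log ‖x‖ = Real.log ‖x‖ + Real.log ‖x‖ by ring,
        exp_add, exp_log hn, sq]
    conv_lhs => rw [e3]
    conv_lhs => enter [2]; rw [hθ]
    rw [pol_smul]
    congr 1; ring
  rw [e1, e2]
  beta_reduce at this
  linarith

end
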